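/- arXiv:2202.02727 — 2 statements merged into one kernel-verified Lean document; each statement's English description precedes it below -/
import Mathlib

section
/- Let ι be a finite nonempty index set and c : ι → ℝ with c i > 0 for every i. Define β* i = √(c i) / (∑_{k ∈ ι} √(c k)). If β : ι → ℝ satisfies β i > 0 for all i, ∑_{i ∈ ι} β i = 1, and ∑_{i ∈ ι} c i / β i = (∑_{i ∈ ι} √(c i))², then β = β*. In other words, β* is the unique minimizer of the energy objective over the feasible set. -/
/-- The excess of `∑ i, a i ^ 2 / β i` over `(∑ i, a i) ^ 2`, for weights `β` summing to one,
as a weighted sum of squares. -/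
theorem sum_sq_sub_sum_mul_div {ι : Type*} [Fintype ι] (a β : ι → ℝ) (hβ : ∀ i, β i ≠ 0)
    (hsum : ∑ i, β i = 1) :
    ∑ i, (a i - (∑ k, a k) * β i) ^ 2 / β i = ∑ i, a i ^ 2 / β i - (∑ i, a i) ^ 2 := by
  set S := ∑ k, a k with hS
  have expand (i : ι) :
      (a i - S * β i) ^ 2 / β i = a i ^ 2 / β i - 2 * S * a i + S ^ 2 * β i := by
    have := hβ i
    field_simp
    ring
  simp_rw [expand, Finset.sum_add_distrib, Finset.sum_sub_distrib, ← Finset.mul_sum, hsum, ← hS]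
  ring


/-- Uniqueness of the minimizer: any feasible `β` attaining the optimal value
`(∑ i, √(c i))²` must equal `β*`. -/
theorem bandwidth_allocation_unique_minimizer
    {ι : Type*} [Fintype ι] [Nonempty ι] (c : ι → ℝ) (hc : ∀ i, 0 < c i)
    (βstar : ι → ℝ)
    (hβstar : ∀ i, βstar i = Real.sqrt (c i) / ∑ k, Real.sqrt (c k))
    (β : ι → ℝ) (hβ : ∀ i, 0 < β i) (hsum : ∑ i, β i = 1)
    (hval : ∑ i, c i / β i = (∑ i, Real.sqrt (c i)) ^ 2) :
    β = βstar := by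
  have hS : 0 < ∑ k, Real.sqrt (c k) :=
    Finset.sum_pos (fun i _ => Real.sqrt_pos.2 (hc i)) Finset.univ_nonempty
  have hzero := sum_sq_sub_sum_mul_div (fun i => Real.sqrt (c i)) β (fun i => (hβ i).ne') hsum
  simp_rw [Real.sq_sqrt (hc _).le, hval, sub_self] at hzero
  rw [Finset.sum_eq_zero_iff_of_nonneg
    (fun i _ => div_nonneg (sq_nonneg _) (hβ i).le)] at hzero
  funext i
  have hi := hzero i (Finset.mem_univ i)
  rw [div_eq_zero_iff, or_iff_left (hβ i).ne', sq_eq_zero_iff, sub_eq_zero] at hi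
  rw [hβstar, eq_div_iff hS.ne', hi, mul_comm]
end

section
/- Let ι be a finite nonempty index set with n = |ι| ≥ 1 elements, and let p, Z, L : ι → ℝ and B : ℝ satisfy p i > 0, Z i > 0, L i > 0 for all i, and B > 0. For bandwidth fractions β : ι → ℝ with β i > 0 and ∑_{i ∈ ι} β i = 1, define the average energy E(β) = (1/n) ∑_{i ∈ ι} (p i · Z i) / (β i · B · L i). Then the minimum of E over all such β equals (∑_{i ∈ ι} √((p i · Z i) / (n · B · L i)))², and it is attained at β i = √((p i Z i)/(L i)) / ∑_{k ∈ ι} √((p k Z k)/(L k)). -/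
/-- Weights proportional to `c` attain equality in Sedrakyan's inequality. -/
theorem sum_sq_div_normalized {ι : Type*} (s : Finset ι) (c : ι → ℝ)
    (hc : ∀ i ∈ s, c i ≠ 0) :
    ∑ i ∈ s, c i ^ 2 / (c i / ∑ k ∈ s, c k) = (∑ i ∈ s, c i) ^ 2 := by
  rw [sq (∑ i ∈ s, c i), Finset.sum_mul]
  refine Finset.sum_congr rfl fun i hi ↦ ?_
  rw [div_div_eq_mul_div, sq, mul_assoc, mul_div_cancel_left₀ _ (hc i hi)]


/-- Theorem 1 in terms of the communication model: minimizing the average uplink energy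
`E(β) = (1/n) ∑ i, (p i * Z i) / (β i * B * L i)` over positive bandwidth fractions
summing to 1 yields the minimum `(∑ i, √((p i * Z i) / (n * B * L i)))²`, attained at
`β i = √(p i * Z i / L i) / ∑ k, √(p k * Z k / L k)`. -/
theorem average_energy_minimization
    {ι : Type*} [Fintype ι] [Nonempty ι] (n : ℕ) (hn : n = Fintype.card ι) (hn1 : 1 ≤ n)
    (p Z L : ι → ℝ) (B : ℝ)
    (hp : ∀ i, 0 < p i) (hZ : ∀ i, 0 < Z i) (hL : ∀ i, 0 < L i) (hB : 0 < B)
    (E : (ι → ℝ) → ℝ)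
    (hE : ∀ β, E β = (1 / (n : ℝ)) * ∑ i, (p i * Z i) / (β i * B * L i))
    (βstar : ι → ℝ)
    (hβstar : ∀ i, βstar i =
      Real.sqrt (p i * Z i / L i) / ∑ k, Real.sqrt (p k * Z k / L k)) :
    ((∀ i, 0 < βstar i) ∧ ∑ i, βstar i = 1) ∧
    E βstar = (∑ i, Real.sqrt ((p i * Z i) / ((n : ℝ) * B * L i))) ^ 2 ∧
    ∀ β : ι → ℝ, (∀ i, 0 < β i) → ∑ i, β i = 1 →
      E β ≥ (∑ i, Real.sqrt ((p i * Z i) / ((n : ℝ) * B * L i))) ^ 2 := by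
  have hn0 : (0 : ℝ) < n := by exact_mod_cast hn1
  have hnB : (0 : ℝ) < n * B := mul_pos hn0 hB
  set c : ι → ℝ := fun i ↦ Real.sqrt (p i * Z i / (n * B * L i)) with hc
  have hc_pos : ∀ i, 0 < c i := fun i ↦
    Real.sqrt_pos.2 (div_pos (mul_pos (hp i) (hZ i)) (mul_pos hnB (hL i)))
  have hc_sq : ∀ i, c i ^ 2 = p i * Z i / (n * B * L i) := fun i ↦
    Real.sq_sqrt (div_pos (mul_pos (hp i) (hZ i)) (mul_pos hnB (hL i))).le
  have hE_eq : ∀ β, E β = ∑ i, c i ^ 2 / β i := by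
    intro β
    rw [hE, Finset.mul_sum]
    refine Finset.sum_congr rfl fun i _ ↦ ?_
    rw [hc_sq, div_mul_div_comm, one_mul, div_div]
    congr 1
    ring
  have hsqrt : ∀ i, Real.sqrt (p i * Z i / L i) = Real.sqrt (n * B) * c i := by
    intro i
    rw [hc, ← Real.sqrt_mul hnB.le]
    congr 1
    have := (hL i).ne'
    field_simp
  have hS : 0 < ∑ i, c i := Finset.sum_pos (fun i _ ↦ hc_pos i) Finset.univ_nonempty
  have hβ : βstar = fun i ↦ c i / ∑ k, c k := by
    funext i
    simp only [hβstar, hsqrt, ← Finset.mul_sum]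
    exact mul_div_mul_left _ _ (Real.sqrt_pos.2 hnB).ne'
  refine ⟨⟨fun i ↦ ?_, ?_⟩, ?_, fun β hβ_pos hβ_sum ↦ ?_⟩
  · rw [hβ]
    exact div_pos (hc_pos i) hS
  · rw [hβ, ← Finset.sum_div, div_self hS.ne']
  · rw [hE_eq, hβ]
    exact sum_sq_div_normalized _ c fun i _ ↦ (hc_pos i).ne'
  · rw [hE_eq]
    simpa only [hβ_sum, div_one] using
      Finset.sq_sum_div_le_sum_sq_div Finset.univ c fun i _ ↦ hβ_pos i
end
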